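/- There exists a nonzero constant c₁ ∈ ℂ such that for all z ∈ ℂ ∖ ({0} ∪ {±q^k : k ∈ ℤ}): h_q(z) = c₁ · z (q z²; q²)_∞ (q z^{−2}; q²)_∞ / ((z²; q²)_∞ (q² z^{−2}; q²)_∞). -/

import Mathlib

open Complex Topology

/-- The function `h_q(z) = ∑_{k=-∞}^{∞} 2 z q^k / (z² - q^{2k})`. -/
noncomputable def hqfun (q : ℝ) (z : ℂ) : ℂ :=
  ∑' k : ℤ, 2 * z * (q : ℂ) ^ k / (z ^ 2 - (q : ℂ) ^ (2 * k))

/-- The q-Pochhammer symbol `(a;qq)_∞ = ∏_{j=0}^∞ (1 - a qq^j)`. -/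
noncomputable def qpoch (a qq : ℂ) : ℂ := ∏' j : ℕ, (1 - a * qq ^ j)

open Filter Set

section qPochhammer

lemma summable_norm_mul_pow {Q : ℂ} (hQ : ‖Q‖ < 1) (a : ℂ) :
    Summable fun j : ℕ => ‖-(a * Q ^ j)‖ := by
  simpa using (summable_geometric_of_lt_one (norm_nonneg _) hQ).mul_left ‖a‖

lemma multipliable_one_sub_mul_pow_succ {Q : ℂ} (hQ : ‖Q‖ < 1) (a : ℂ) :
    Multipliable fun j : ℕ => 1 - a * Q ^ (j + 1) := by
  have := multipliable_one_add_of_summable (f := fun j : ℕ => -(a * Q * Q ^ j))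
    (summable_norm_mul_pow hQ (a * Q))
  simpa only [← sub_eq_add_neg, mul_assoc, ← pow_succ'] using this

lemma qpoch_eq_one_sub_mul {Q : ℂ} (hQ : ‖Q‖ < 1) (a : ℂ) :
    qpoch a Q = (1 - a) * qpoch (a * Q) Q := by
  have h0 := tprod_eq_zero_mul' (f := fun j : ℕ => 1 - a * Q ^ j)
    (multipliable_one_sub_mul_pow_succ hQ a)
  have h1 : qpoch (a * Q) Q = ∏' j : ℕ, (1 - a * Q ^ (j + 1)) := by
    unfold qpoch
    refine tprod_congr fun j => ?_
    rw [pow_succ', mul_assoc]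
  rw [h1]
  unfold qpoch
  rw [h0, pow_zero, mul_one]

lemma qpoch_ne_zero {Q : ℂ} (hQ : ‖Q‖ < 1) {a : ℂ} (ha : ‖a‖ < 1) : qpoch a Q ≠ 0 := by
  have h := tprod_one_add_ne_zero_of_summable (f := fun j : ℕ => -(a * Q ^ j)) (fun j h0 => ?_)
    (summable_norm_mul_pow hQ a)
  · simpa only [qpoch, sub_eq_add_neg] using h
  · have h1 : a * Q ^ j = 1 := by linear_combination -h0
    have h2 : ‖a * Q ^ j‖ < 1 := by
      rw [norm_mul, norm_pow]
      exact (mul_le_of_le_one_right (norm_nonneg _)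
        (pow_le_one₀ (norm_nonneg _) hQ.le)).trans_lt ha
    rw [h1] at h2
    simp at h2

lemma differentiable_qpoch {Q : ℂ} (hQ : ‖Q‖ < 1) : Differentiable ℂ fun a => qpoch a Q := by
  intro a
  have h : HasProdLocallyUniformlyOn (fun (j : ℕ) (x : ℂ) => 1 + -(x * Q ^ j))
      (fun x => ∏' j : ℕ, (1 + -(x * Q ^ j))) (Metric.ball 0 (‖a‖ + 1)) := by
    refine Summable.hasProdLocallyUniformlyOn_nat_one_add (u := fun j => (‖a‖ + 1) * ‖Q‖ ^ j)
      Metric.isOpen_ball ((summable_geometric_of_lt_one (norm_nonneg _) hQ).mul_left _)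
      (.of_forall fun j x hx => ?_) (fun j => by fun_prop)
    rw [norm_neg, norm_mul, norm_pow]
    have : ‖x‖ < ‖a‖ + 1 := by simpa using hx
    gcongr
  have hd := h.differentiableOn
    (.of_forall fun _ => by simpa [Finset.prod_fn] using
      DifferentiableOn.finsetProd (fun _ _ => by fun_prop)) Metric.isOpen_ball
  simpa only [qpoch, sub_eq_add_neg] using
    hd.differentiableAt (Metric.isOpen_ball.mem_nhds (by simp))

end qPochhammer

section MultiplicativelyPeriodic

lemma apply_zpow_mul_of_periodic {q : ℂ} (hq : q ≠ 0) {f : ℂ → ℂ}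
    (hf : ∀ z, z ≠ 0 → f (q * z) = f z) (n : ℤ) {z : ℂ} (hz : z ≠ 0) : f (q ^ n * z) = f z := by
  induction n with
  | zero => simp
  | succ n ih =>
    rw [← ih, ← hf (q ^ (n : ℤ) * z) (mul_ne_zero (zpow_ne_zero _ hq) hz), zpow_add_one₀ hq,
      ← mul_assoc, mul_comm q]
  | pred n ih =>
    rw [← ih, ← hf _ (mul_ne_zero (zpow_ne_zero _ hq) hz), zpow_sub_one₀ hq]
    congr 1
    field_simp

lemma exists_zpow_mul_norm_mem {q : ℝ} (hq0 : 0 < q) (hq1 : q < 1) {z : ℂ} (hz : z ≠ 0) :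
    ∃ n : ℤ, q < ‖(q : ℂ) ^ n * z‖ ∧ ‖(q : ℂ) ^ n * z‖ ≤ 1 := by
  obtain ⟨n, hn⟩ := exists_mem_Ioc_zpow (norm_pos_iff.2 hz) ((one_lt_inv₀ hq0).2 hq1)
  rw [inv_zpow, inv_zpow] at hn
  have hp : 0 < q ^ (n + 1) := zpow_pos hq0 _
  refine ⟨n + 1, ?_⟩
  rw [norm_mul, norm_zpow, Complex.norm_real, Real.norm_of_nonneg hq0.le]
  constructor
  · calc q = q ^ (n + 1) * (q ^ n)⁻¹ := by rw [zpow_add_one₀ hq0.ne']; field_simp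
      _ < _ := mul_lt_mul_of_pos_left hn.1 hp
  · calc _ ≤ q ^ (n + 1) * (q ^ (n + 1))⁻¹ := mul_le_mul_of_nonneg_left hn.2 hp.le
      _ = 1 := mul_inv_cancel₀ hp.ne'

/-- A multiplicatively periodic function holomorphic on a fundamental annulus is holomorphic on
the punctured plane. -/
lemma differentiableAt_of_periodic {q : ℝ} (hq0 : 0 < q) (hq1 : q < 1) {f : ℂ → ℂ}
    (hf : ∀ z, z ≠ 0 → f (q * z) = f z)
    (hd : ∀ z, q < ‖z‖ → ‖z‖ ≤ 1 → DifferentiableAt ℂ f z) {z : ℂ} (hz : z ≠ 0) :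
    DifferentiableAt ℂ f z := by
  have hqC : (q : ℂ) ≠ 0 := by exact_mod_cast hq0.ne'
  obtain ⟨n, h1, h2⟩ := exists_zpow_mul_norm_mem hq0 hq1 hz
  have h : DifferentiableAt ℂ (fun w => f ((q : ℂ) ^ n * w)) z :=
    (hd _ h1 h2).comp z (by fun_prop)
  refine h.congr_of_eventuallyEq ?_
  filter_upwards [isOpen_ne.mem_nhds hz] with w hw
  exact (apply_zpow_mul_of_periodic hqC hf n hw).symm

/-- A multiplicatively periodic holomorphic function on the punctured plane is constant. -/
lemma apply_eq_apply_of_periodic {q : ℝ} (hq0 : 0 < q) (hq1 : q < 1) {f : ℂ → ℂ}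
    (hf : ∀ z, z ≠ 0 → f (q * z) = f z) (hd : ∀ z, z ≠ 0 → DifferentiableAt ℂ f z)
    {z w : ℂ} (hz : z ≠ 0) (hw : w ≠ 0) : f z = f w := by
  have hqC : (q : ℂ) ≠ 0 := by exact_mod_cast hq0.ne'
  have hg : Differentiable ℂ (fun x => f (exp x)) := fun x =>
    (hd _ (exp_ne_zero x)).comp x differentiableAt_exp
  have hK : IsCompact {z : ℂ | q ≤ ‖z‖ ∧ ‖z‖ ≤ 1} := by
    refine (isCompact_closedBall (0 : ℂ) 1).of_isClosed_subset ?_ fun z hz => by simpa using hz.2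
    exact (isClosed_le continuous_const continuous_norm).inter
      (isClosed_le continuous_norm continuous_const)
  have hc : ContinuousOn f {z : ℂ | q ≤ ‖z‖ ∧ ‖z‖ ≤ 1} := fun z hz =>
    (hd z (norm_pos_iff.1 (hq0.trans_le hz.1))).continuousAt.continuousWithinAt
  have hb : Bornology.IsBounded (range fun x => f (exp x)) := by
    refine (hK.image_of_continuousOn hc).isBounded.subset ?_
    rintro _ ⟨x, rfl⟩
    obtain ⟨n, h1, h2⟩ := exists_zpow_mul_norm_mem hq0 hq1 (exp_ne_zero x)
    exact ⟨_, ⟨h1.le, h2⟩, apply_zpow_mul_of_periodic hqC hf n (exp_ne_zero x)⟩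
  have := hg.apply_eq_apply_of_bounded hb (log z) (log w)
  simpa [exp_log hz, exp_log hw] using this

/-- A function that is antisymmetric under inversion and agrees near `1` with a function continuous
there also agrees with it at `1`. -/
lemma eventuallyEq_nhds_one_of_inv_neg {f k : ℂ → ℂ} (hf : ∀ z, z ≠ 0 → f z⁻¹ = -f z)
    (hk : ContinuousAt k 1) (h : f =ᶠ[𝓝[≠] 1] k) : f =ᶠ[𝓝 1] k := by
  have h0 : f 1 = 0 := by
    have := hf 1 one_ne_zero
    rw [inv_one] at this
    exact self_eq_neg.1 this
  have hl : Tendsto f (𝓝[≠] 1) (𝓝 (k 1)) :=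
    (hk.tendsto.mono_left nhdsWithin_le_nhds).congr' h.symm
  have hi : Tendsto (fun z : ℂ => z⁻¹) (𝓝[≠] 1) (𝓝[≠] 1) := by
    refine tendsto_nhdsWithin_iff.2 ⟨?_, ?_⟩
    · have : ContinuousAt (fun z : ℂ => z⁻¹) 1 := continuousAt_inv₀ one_ne_zero
      simpa [ContinuousAt] using this.tendsto.mono_left nhdsWithin_le_nhds
    · filter_upwards [self_mem_nhdsWithin] with z hz
      simpa using hz
  have hneg : Tendsto f (𝓝[≠] 1) (𝓝 (-k 1)) := by
    refine (hl.comp hi).neg.congr' ?_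
    filter_upwards [nhdsWithin_le_nhds (isOpen_ne.mem_nhds (one_ne_zero (α := ℂ)))] with z hz
    simp [hf z hz]
  have hk0 : k 1 = 0 := self_eq_neg.1 (tendsto_nhds_unique hl hneg)
  rw [eventuallyEq_nhdsWithin_iff] at h
  filter_upwards [h] with z hz
  by_cases h1 : z = 1
  · rw [h1, h0, hk0]
  · exact hz h1

end MultiplicativelyPeriodic

section LambertSeries

lemma hqfun_mul {q : ℝ} (hq : q ≠ 0) (z : ℂ) : hqfun q (q * z) = hqfun q z := by
  have hqC : (q : ℂ) ≠ 0 := by exact_mod_cast hq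
  unfold hqfun
  rw [← (Equiv.addRight (1 : ℤ)).tsum_eq]
  refine tsum_congr fun k => ?_
  simp only [Equiv.coe_addRight]
  rw [mul_add, zpow_add₀ hqC, zpow_add₀ hqC, zpow_one,
    show (2 * 1 : ℤ) = (2 : ℕ) by norm_num, zpow_natCast,
    show ((q : ℂ) * z) ^ 2 - (q : ℂ) ^ (2 * k) * (q : ℂ) ^ 2
      = (q : ℂ) ^ 2 * (z ^ 2 - (q : ℂ) ^ (2 * k)) by ring,
    show 2 * ((q : ℂ) * z) * ((q : ℂ) ^ k * q) = (q : ℂ) ^ 2 * (2 * z * (q : ℂ) ^ k) by ring]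
  exact mul_div_mul_left _ _ (pow_ne_zero 2 hqC)

lemma hqfun_neg (q : ℝ) (z : ℂ) : hqfun q (-z) = -hqfun q z := by
  unfold hqfun
  rw [← tsum_neg]
  refine tsum_congr fun k => ?_
  rw [neg_sq, ← neg_div]
  ring_nf

lemma hqfun_term_neg {q z : ℂ} (hq : q ≠ 0) (hz : z ≠ 0) (k : ℤ) :
    2 * z * q ^ (-k) / (z ^ 2 - q ^ (2 * -k))
      = -(2 * z⁻¹ * q ^ k / (z⁻¹ ^ 2 - q ^ (2 * k))) := by
  have hk : q ^ k ≠ 0 := zpow_ne_zero _ hq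
  have h2 : ∀ m : ℤ, q ^ (2 * m) = (q ^ m) ^ 2 := fun m => by
    rw [mul_comm, zpow_mul]; norm_cast
  rw [h2, h2, zpow_neg]
  generalize q ^ k = x at hk
  by_cases h : z ^ 2 * x ^ 2 = 1
  · have e1 : z ^ 2 - x⁻¹ ^ 2 = 0 := by field_simp; linear_combination h
    have e2 : z⁻¹ ^ 2 - x ^ 2 = 0 := by field_simp; linear_combination -h
    rw [e1, e2]; simp
  · have e1 : z ^ 2 - x⁻¹ ^ 2 = (z ^ 2 * x ^ 2 - 1) / x ^ 2 := by field_simp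
    have e2 : z⁻¹ ^ 2 - x ^ 2 = -(z ^ 2 * x ^ 2 - 1) / z ^ 2 := by field_simp; ring
    have e3 : z ^ 2 * x ^ 2 - 1 ≠ 0 := sub_ne_zero.2 h
    rw [e1, e2]
    field_simp

lemma hqfun_inv {q : ℝ} (hq : q ≠ 0) {z : ℂ} (hz : z ≠ 0) : hqfun q z⁻¹ = -hqfun q z := by
  have hqC : (q : ℂ) ≠ 0 := by exact_mod_cast hq
  unfold hqfun
  rw [← (Equiv.neg ℤ).tsum_eq, ← tsum_neg]
  refine tsum_congr fun k => ?_
  simp only [Equiv.neg_apply]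
  rw [hqfun_term_neg hqC (inv_ne_zero hz), inv_inv]

/-- The part of the series `h_q` indexed by positive `k`. -/
noncomputable def hqPos (q : ℝ) (z : ℂ) : ℂ :=
  ∑' n : ℕ, 2 * z * (q : ℂ) ^ (n + 1) / (z ^ 2 - (q : ℂ) ^ (2 * (n + 1)))

lemma norm_sq_sub_pow_ge {q : ℝ} (hq0 : 0 < q) (hq1 : q < 1) {r : ℝ} (hr : q < r) {z : ℂ}
    (hz : r ≤ ‖z‖) (n : ℕ) : r ^ 2 - q ^ 2 ≤ ‖z ^ 2 - (q : ℂ) ^ (2 * (n + 1))‖ := by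
  have h1 : ‖(q : ℂ) ^ (2 * (n + 1))‖ ≤ q ^ 2 := by
    rw [norm_pow, Complex.norm_real, Real.norm_of_nonneg hq0.le]
    exact pow_le_pow_of_le_one hq0.le hq1.le (by omega)
  have h2 : r ^ 2 ≤ ‖z ^ 2‖ := by
    rw [norm_pow]
    exact pow_le_pow_left₀ (hq0.trans hr).le hz 2
  linarith [norm_sub_norm_le (z ^ 2) ((q : ℂ) ^ (2 * (n + 1)))]

lemma norm_hqPos_term_le {q : ℝ} (hq0 : 0 < q) (hq1 : q < 1) {r R : ℝ} (hr : q < r) {z : ℂ}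
    (hz : r ≤ ‖z‖) (hz' : ‖z‖ ≤ R) (n : ℕ) :
    ‖2 * z * (q : ℂ) ^ (n + 1) / (z ^ 2 - (q : ℂ) ^ (2 * (n + 1)))‖
      ≤ 2 * R / (r ^ 2 - q ^ 2) * q ^ (n + 1) := by
  have h0 : 0 < r ^ 2 - q ^ 2 := by nlinarith
  have h1 := norm_sq_sub_pow_ge hq0 hq1 hr hz n
  rw [norm_div, norm_mul, norm_mul, norm_pow, Complex.norm_real, Real.norm_of_nonneg hq0.le,
    Complex.norm_ofNat, div_mul_eq_mul_div]
  have hR : 0 ≤ R := (norm_nonneg z).trans hz'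
  gcongr

lemma summable_const_mul_pow_succ {q : ℝ} (hq0 : 0 < q) (hq1 : q < 1) (C : ℝ) :
    Summable fun n : ℕ => C * q ^ (n + 1) :=
  ((summable_nat_add_iff 1).2 (summable_geometric_of_lt_one hq0.le hq1)).mul_left C

lemma summable_hqPos {q : ℝ} (hq0 : 0 < q) (hq1 : q < 1) {z : ℂ} (hz : q < ‖z‖) :
    Summable fun n : ℕ => 2 * z * (q : ℂ) ^ (n + 1) / (z ^ 2 - (q : ℂ) ^ (2 * (n + 1))) :=
  .of_norm_bounded (summable_const_mul_pow_succ hq0 hq1 _)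
    (norm_hqPos_term_le hq0 hq1 hz le_rfl le_rfl)

lemma differentiableAt_hqPos {q : ℝ} (hq0 : 0 < q) (hq1 : q < 1) {z : ℂ} (hz : q < ‖z‖) :
    DifferentiableAt ℂ (hqPos q) z := by
  obtain ⟨r, hr, hrz⟩ := exists_between hz
  have hU : IsOpen {w : ℂ | r < ‖w‖ ∧ ‖w‖ < ‖z‖ + 1} :=
    (isOpen_lt continuous_const continuous_norm).inter (isOpen_lt continuous_norm continuous_const)
  have hd : DifferentiableOn ℂ (hqPos q) {w : ℂ | r < ‖w‖ ∧ ‖w‖ < ‖z‖ + 1} := by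
    refine differentiableOn_tsum_of_summable_norm
      (summable_const_mul_pow_succ hq0 hq1 (2 * (‖z‖ + 1) / (r ^ 2 - q ^ 2))) (fun n => ?_) hU
      (fun n w hw => norm_hqPos_term_le hq0 hq1 hr hw.1.le hw.2.le n)
    refine DifferentiableOn.div (by fun_prop) (by fun_prop) fun w hw h0 => ?_
    have := norm_sq_sub_pow_ge hq0 hq1 hr hw.1.le n
    rw [h0, norm_zero] at this
    nlinarith
  exact hd.differentiableAt (hU.mem_nhds ⟨hrz, by linarith⟩)

lemma hqfun_eq_hqPos {q : ℝ} (hq0 : 0 < q) (hq1 : q < 1) {z : ℂ} (hz : q < ‖z‖)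
    (hz' : q < ‖z⁻¹‖) :
    hqfun q z = hqPos q z - hqPos q z⁻¹ + 2 * z / (z ^ 2 - 1) := by
  have hqC : (q : ℂ) ≠ 0 := by exact_mod_cast hq0.ne'
  have hz0 : z ≠ 0 := norm_pos_iff.1 (hq0.trans hz)
  have e : ∀ (w : ℂ) (n : ℕ), 2 * w * (q : ℂ) ^ ((n : ℤ) + 1)
      / (w ^ 2 - (q : ℂ) ^ (2 * ((n : ℤ) + 1)))
      = 2 * w * (q : ℂ) ^ (n + 1) / (w ^ 2 - (q : ℂ) ^ (2 * (n + 1))) := fun w n => by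
    norm_cast
  have h1 : HasSum (fun n : ℕ => 2 * z * (q : ℂ) ^ ((n : ℤ) + 1)
      / (z ^ 2 - (q : ℂ) ^ (2 * ((n : ℤ) + 1)))) (hqPos q z) := by
    simp only [e]
    exact (summable_hqPos hq0 hq1 hz).hasSum
  have h2 : HasSum (fun n : ℕ => 2 * z * (q : ℂ) ^ (-((n : ℤ) + 1))
      / (z ^ 2 - (q : ℂ) ^ (2 * (-((n : ℤ) + 1))))) (-hqPos q z⁻¹) := by
    simp only [hqfun_term_neg hqC hz0, e]
    exact (summable_hqPos hq0 hq1 hz').hasSum.neg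
  have h := (HasSum.of_add_one_of_neg_add_one
    (f := fun k : ℤ => 2 * z * (q : ℂ) ^ k / (z ^ 2 - (q : ℂ) ^ (2 * k))) h1 h2).tsum_eq
  rw [hqfun, h]
  simp
  ring

end LambertSeries

section ThetaQuotient

/-- The numerator `(q z²; q²)_∞ (q z⁻²; q²)_∞`. -/
noncomputable def thetaNum (q : ℝ) (z : ℂ) : ℂ :=
  qpoch ((q : ℂ) * z ^ 2) ((q : ℂ) ^ 2) * qpoch ((q : ℂ) * z⁻¹ ^ 2) ((q : ℂ) ^ 2)

/-- The denominator `(z²; q²)_∞ (q² z⁻²; q²)_∞`. -/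
noncomputable def thetaDen (q : ℝ) (z : ℂ) : ℂ :=
  qpoch (z ^ 2) ((q : ℂ) ^ 2) * qpoch ((q : ℂ) ^ 2 * z⁻¹ ^ 2) ((q : ℂ) ^ 2)

/-- The denominator with the factor `1 - z²` removed. -/
noncomputable def thetaDenReg (q : ℝ) (z : ℂ) : ℂ :=
  qpoch ((q : ℂ) ^ 2 * z ^ 2) ((q : ℂ) ^ 2) * qpoch ((q : ℂ) ^ 2 * z⁻¹ ^ 2) ((q : ℂ) ^ 2)

/-- The theta quotient on the right-hand side of the product formula for `h_q`. -/
noncomputable def thetaQuot (q : ℝ) (z : ℂ) : ℂ := z * thetaNum q z / thetaDen q z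

lemma norm_ofReal_sq_lt_one {q : ℝ} (hq0 : 0 < q) (hq1 : q < 1) : ‖(q : ℂ) ^ 2‖ < 1 := by
  rw [norm_pow, Complex.norm_real, Real.norm_of_nonneg hq0.le]
  nlinarith

lemma thetaDen_eq {q : ℝ} (hq0 : 0 < q) (hq1 : q < 1) (z : ℂ) :
    thetaDen q z = (1 - z ^ 2) * thetaDenReg q z := by
  rw [thetaDen, thetaDenReg, qpoch_eq_one_sub_mul (norm_ofReal_sq_lt_one hq0 hq1) (z ^ 2),
    mul_comm (z ^ 2) ((q : ℂ) ^ 2), mul_assoc]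

lemma thetaDenReg_inv (q : ℝ) (z : ℂ) : thetaDenReg q z⁻¹ = thetaDenReg q z := by
  rw [thetaDenReg, thetaDenReg, inv_inv, mul_comm]

lemma thetaNum_inv (q : ℝ) (z : ℂ) : thetaNum q z⁻¹ = thetaNum q z := by
  rw [thetaNum, thetaNum, inv_inv, mul_comm]

lemma thetaNum_eq_mul {q : ℝ} (hq0 : 0 < q) (hq1 : q < 1) {z : ℂ} (hz : z ≠ 0) :
    thetaNum q z = -(q * z ^ 2) * thetaNum q (q * z) := by
  have hQ := norm_ofReal_sq_lt_one hq0 hq1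
  have hqC : (q : ℂ) ≠ 0 := by exact_mod_cast hq0.ne'
  rw [thetaNum, thetaNum, qpoch_eq_one_sub_mul hQ ((q : ℂ) * z ^ 2),
    qpoch_eq_one_sub_mul hQ ((q : ℂ) * ((q : ℂ) * z)⁻¹ ^ 2),
    show (q : ℂ) * z ^ 2 * (q : ℂ) ^ 2 = (q : ℂ) * ((q : ℂ) * z) ^ 2 by ring,
    show (q : ℂ) * ((q : ℂ) * z)⁻¹ ^ 2 * (q : ℂ) ^ 2 = (q : ℂ) * z⁻¹ ^ 2 by field_simp,
    show 1 - (q : ℂ) * z ^ 2 = -(q * z ^ 2) * (1 - (q : ℂ) * ((q : ℂ) * z)⁻¹ ^ 2) by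
      field_simp; ring]
  ring

lemma thetaDen_eq_mul {q : ℝ} (hq0 : 0 < q) (hq1 : q < 1) {z : ℂ} (hz : z ≠ 0) :
    thetaDen q z = -z ^ 2 * thetaDen q (q * z) := by
  have hQ := norm_ofReal_sq_lt_one hq0 hq1
  have hqC : (q : ℂ) ≠ 0 := by exact_mod_cast hq0.ne'
  rw [thetaDen, thetaDen, qpoch_eq_one_sub_mul hQ (z ^ 2),
    qpoch_eq_one_sub_mul hQ ((q : ℂ) ^ 2 * ((q : ℂ) * z)⁻¹ ^ 2),
    show z ^ 2 * (q : ℂ) ^ 2 = ((q : ℂ) * z) ^ 2 by ring,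
    show (q : ℂ) ^ 2 * ((q : ℂ) * z)⁻¹ ^ 2 * (q : ℂ) ^ 2 = (q : ℂ) ^ 2 * z⁻¹ ^ 2 by field_simp,
    show 1 - z ^ 2 = -z ^ 2 * (1 - (q : ℂ) ^ 2 * ((q : ℂ) * z)⁻¹ ^ 2) by field_simp; ring]
  ring

lemma thetaQuot_mul {q : ℝ} (hq0 : 0 < q) (hq1 : q < 1) {z : ℂ} (hz : z ≠ 0) :
    thetaQuot q (q * z) = thetaQuot q z := by
  have hqC : (q : ℂ) ≠ 0 := by exact_mod_cast hq0.ne'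
  rw [thetaQuot, thetaQuot, thetaNum_eq_mul hq0 hq1 hz, thetaDen_eq_mul hq0 hq1 hz,
    show z * (-(q * z ^ 2) * thetaNum q (q * z)) = -z ^ 2 * (q * z * thetaNum q (q * z)) by ring,
    mul_div_mul_left _ _ (neg_ne_zero.2 (pow_ne_zero 2 hz))]

lemma thetaQuot_inv {q : ℝ} (hq0 : 0 < q) (hq1 : q < 1) {z : ℂ} (hz : z ≠ 0) :
    thetaQuot q z⁻¹ = -thetaQuot q z := by
  have hD : thetaDen q z = -z ^ 2 * thetaDen q z⁻¹ := by
    rw [thetaDen_eq hq0 hq1, thetaDen_eq hq0 hq1, thetaDenReg_inv]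
    field_simp
    ring
  rw [thetaQuot, thetaQuot, hD, thetaNum_inv,
    show z * thetaNum q z = -z ^ 2 * -(z⁻¹ * thetaNum q z) by field_simp,
    mul_div_mul_left _ _ (neg_ne_zero.2 (pow_ne_zero 2 hz)), neg_div, neg_neg]

lemma thetaQuot_neg (q : ℝ) (z : ℂ) : thetaQuot q (-z) = -thetaQuot q z := by
  simp [thetaQuot, thetaNum, thetaDen, inv_neg, neg_div]

lemma thetaDenReg_ne_zero {q : ℝ} (hq0 : 0 < q) (hq1 : q < 1) {z : ℂ} (hz : q < ‖z‖)
    (hz' : q < ‖z⁻¹‖) : thetaDenReg q z ≠ 0 := by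
  have hQ := norm_ofReal_sq_lt_one hq0 hq1
  have key : ∀ w : ℂ, w ≠ 0 → q < ‖w⁻¹‖ → ‖(q : ℂ) ^ 2 * w ^ 2‖ < 1 := fun w hw0 hw => by
    rw [← mul_pow, norm_pow, norm_mul, Complex.norm_real, Real.norm_of_nonneg hq0.le]
    rw [norm_inv, lt_inv_comm₀ hq0 (norm_pos_iff.2 hw0)] at hw
    have : q * ‖w‖ < 1 := by
      calc q * ‖w‖ < q * q⁻¹ := mul_lt_mul_of_pos_left hw hq0
        _ = 1 := mul_inv_cancel₀ hq0.ne'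
    exact pow_lt_one₀ (by positivity) this two_ne_zero
  have hz0 : z ≠ 0 := norm_pos_iff.1 (hq0.trans hz)
  exact mul_ne_zero (qpoch_ne_zero hQ (key z hz0 hz'))
    (qpoch_ne_zero hQ (key z⁻¹ (inv_ne_zero hz0) (by rwa [inv_inv])))

lemma thetaNum_one_ne_zero {q : ℝ} (hq0 : 0 < q) (hq1 : q < 1) : thetaNum q 1 ≠ 0 := by
  have h : ‖(q : ℂ)‖ < 1 := by rwa [Complex.norm_real, Real.norm_of_nonneg hq0.le]
  have := qpoch_ne_zero (norm_ofReal_sq_lt_one hq0 hq1) h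
  simpa [thetaNum] using this

lemma differentiableAt_thetaNum {q : ℝ} (hq0 : 0 < q) (hq1 : q < 1) {z : ℂ} (hz : z ≠ 0) :
    DifferentiableAt ℂ (thetaNum q) z := by
  have hP := differentiable_qpoch (norm_ofReal_sq_lt_one hq0 hq1)
  have hi : DifferentiableAt ℂ (fun w : ℂ => w⁻¹) z := differentiableAt_inv hz
  exact ((hP _).comp z (f := fun w : ℂ => (q : ℂ) * w ^ 2) (by fun_prop)).mul
    ((hP _).comp z (f := fun w : ℂ => (q : ℂ) * w⁻¹ ^ 2) (by fun_prop))

lemma differentiableAt_thetaDenReg {q : ℝ} (hq0 : 0 < q) (hq1 : q < 1) {z : ℂ} (hz : z ≠ 0) :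
    DifferentiableAt ℂ (thetaDenReg q) z := by
  have hP := differentiable_qpoch (norm_ofReal_sq_lt_one hq0 hq1)
  have hi : DifferentiableAt ℂ (fun w : ℂ => w⁻¹) z := differentiableAt_inv hz
  exact ((hP _).comp z (f := fun w : ℂ => (q : ℂ) ^ 2 * w ^ 2) (by fun_prop)).mul
    ((hP _).comp z (f := fun w : ℂ => (q : ℂ) ^ 2 * w⁻¹ ^ 2) (by fun_prop))

end ThetaQuotient

section Difference

lemma isOpen_annulus (q : ℝ) (hq0 : 0 < q) : IsOpen {z : ℂ | q < ‖z‖ ∧ q < ‖z⁻¹‖} := by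
  have : {z : ℂ | q < ‖z‖ ∧ q < ‖z⁻¹‖} = {z : ℂ | q < ‖z‖ ∧ ‖z‖ < q⁻¹} := by
    ext z
    refine and_congr_right fun hz => ?_
    rw [norm_inv, lt_inv_comm₀ hq0 (hq0.trans hz)]
  rw [this]
  exact (isOpen_lt continuous_const continuous_norm).inter
    (isOpen_lt continuous_norm continuous_const)

/-- If `c` cancels the residue at `1`, then `h_q - c F` is holomorphic on the annulus
`q < |z| < q⁻¹`, where `F` is the theta quotient. -/
lemma differentiableAt_hqfun_sub {q : ℝ} (hq0 : 0 < q) (hq1 : q < 1) {c : ℂ}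
    (hc : 2 * thetaDenReg q 1 + c * thetaNum q 1 = 0) {z : ℂ} (hz : q < ‖z‖) (hz' : q < ‖z⁻¹‖) :
    DifferentiableAt ℂ (fun w => hqfun q w - c * thetaQuot q w) z := by
  set f : ℂ → ℂ := fun w => hqfun q w - c * thetaQuot q w with hf
  set V : Set ℂ := {z : ℂ | q < ‖z‖ ∧ q < ‖z⁻¹‖} with hV
  have hVo : IsOpen V := isOpen_annulus q hq0
  have hV0 : ∀ w ∈ V, w ≠ 0 := fun w hw => norm_pos_iff.1 (hq0.trans hw.1)
  set B : ℂ → ℂ := fun w => hqPos q w - hqPos q w⁻¹ with hB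
  set A : ℂ → ℂ := fun w => 2 * w + c * (w * thetaNum q w / thetaDenReg q w) with hA
  have hBd : ∀ w ∈ V, DifferentiableAt ℂ B w := fun w hw =>
    (differentiableAt_hqPos hq0 hq1 hw.1).sub
      ((differentiableAt_hqPos hq0 hq1 hw.2).comp w (differentiableAt_inv (hV0 w hw)))
  have hAd : ∀ w ∈ V, DifferentiableAt ℂ A w := fun w hw => by
    have h1 := differentiableAt_thetaNum hq0 hq1 (hV0 w hw)
    have h2 := differentiableAt_thetaDenReg hq0 hq1 (hV0 w hw)
    have h3 := thetaDenReg_ne_zero hq0 hq1 hw.1 hw.2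
    exact (differentiableAt_id.const_mul 2).add
      (((differentiableAt_id.mul h1).div h2 h3).const_mul c)
  have hfV : ∀ w ∈ V, f w = B w + A w / (w ^ 2 - 1) := fun w hw => by
    simp only [hf, hA, hB, thetaQuot]
    rw [hqfun_eq_hqPos hq0 hq1 hw.1 hw.2, thetaDen_eq hq0 hq1,
      show (1 - w ^ 2) * thetaDenReg q w = -(thetaDenReg q w * (w ^ 2 - 1)) by ring,
      div_neg, ← div_div]
    ring
  have h1V : (1 : ℂ) ∈ V := by simp [hV, hq1]
  have hA1 : A 1 = 0 := by
    have h3 := thetaDenReg_ne_zero hq0 hq1 h1V.1 h1V.2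
    simp only [hA]
    field_simp
    linear_combination hc
  have hinv : ∀ w, w ≠ 0 → f w⁻¹ = -f w := fun w hw => by
    simp only [hf, hqfun_inv hq0.ne' hw, thetaQuot_inv hq0 hq1 hw]
    ring
  have hneg : ∀ w, f w = -f (-w) := fun w => by
    simp only [hf, hqfun_neg, thetaQuot_neg]
    ring
  have hone : DifferentiableAt ℂ f 1 := by
    have hk : DifferentiableAt ℂ (fun w => B w + dslope A 1 w / (w + 1)) 1 := by
      have hs : DifferentiableOn ℂ (dslope A 1) V :=
        (differentiableOn_dslope (hVo.mem_nhds h1V)).2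
          fun w hw => (hAd w hw).differentiableWithinAt
      exact (hBd 1 h1V).add
        ((hs.differentiableAt (hVo.mem_nhds h1V)).div (by fun_prop) (by norm_num))
    refine hk.congr_of_eventuallyEq
      (eventuallyEq_nhds_one_of_inv_neg hinv hk.continuousAt ?_)
    filter_upwards [self_mem_nhdsWithin, nhdsWithin_le_nhds (hVo.mem_nhds h1V)] with w hw hwV
    have hw1 : w - 1 ≠ 0 := sub_ne_zero.2 hw
    rw [hfV w hwV, dslope_of_ne _ hw, slope_def_field, hA1, sub_zero, div_div]
    ring
  by_cases h1 : z = 1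
  · rwa [h1]
  by_cases h2 : z = -1
  · have h : DifferentiableAt ℂ (fun w => -f (-w)) z := by
      refine (DifferentiableAt.comp z (g := f) (f := fun w : ℂ => -w) ?_ (by fun_prop)).neg
      rwa [h2, neg_neg]
    exact h.congr_of_eventuallyEq (.of_forall hneg)
  · have hz1 : z ^ 2 - 1 ≠ 0 := sub_ne_zero.2 fun h =>
      (sq_eq_sq_iff_eq_or_eq_neg.1 (h.trans (one_pow 2).symm)).elim h1 h2
    have hzV : z ∈ V := ⟨hz, hz'⟩
    have h : DifferentiableAt ℂ (fun w => B w + A w / (w ^ 2 - 1)) z :=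
      (hBd z hzV).add ((hAd z hzV).div (by fun_prop) hz1)
    refine h.congr_of_eventuallyEq ?_
    filter_upwards [hVo.mem_nhds hzV] with w hw using hfV w hw

end Difference

theorem statement11 (q : ℝ) (hq0 : 0 < q) (hq1 : q < 1) :
    ∃ c₁ : ℂ, c₁ ≠ 0 ∧
      ∀ z : ℂ, z ≠ 0 → (∀ k : ℤ, z ≠ (q : ℂ) ^ k ∧ z ≠ -((q : ℂ) ^ k)) →
        hqfun q z
          = c₁ * z * qpoch ((q : ℂ) * z ^ 2) ((q : ℂ) ^ 2)
              * qpoch ((q : ℂ) * z⁻¹ ^ 2) ((q : ℂ) ^ 2)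
            / (qpoch (z ^ 2) ((q : ℂ) ^ 2) * qpoch ((q : ℂ) ^ 2 * z⁻¹ ^ 2) ((q : ℂ) ^ 2)) := by
  have hN := thetaNum_one_ne_zero hq0 hq1
  have hE : thetaDenReg q 1 ≠ 0 :=
    thetaDenReg_ne_zero hq0 hq1 (by simpa using hq1) (by simpa using hq1)
  refine ⟨-(2 * thetaDenReg q 1 / thetaNum q 1),
    neg_ne_zero.2 (div_ne_zero (mul_ne_zero two_ne_zero hE) hN), fun z hz _ => ?_⟩
  set c := -(2 * thetaDenReg q 1 / thetaNum q 1) with hc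
  have hc0 : 2 * thetaDenReg q 1 + c * thetaNum q 1 = 0 := by
    rw [hc]
    field_simp
    ring
  set f : ℂ → ℂ := fun w => hqfun q w - c * thetaQuot q w with hf
  have hper : ∀ w, w ≠ 0 → f (q * w) = f w := fun w hw => by
    simp only [hf, hqfun_mul hq0.ne', thetaQuot_mul hq0 hq1 hw]
  have hd : ∀ w, w ≠ 0 → DifferentiableAt ℂ f w := fun w hw =>
    differentiableAt_of_periodic hq0 hq1 hper (fun x hx hx' =>
      differentiableAt_hqfun_sub hq0 hq1 hc0 hx (by
        rw [norm_inv]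
        exact hq1.trans_le ((one_le_inv₀ (hq0.trans hx)).2 hx'))) hw
  have hodd : f (-z) = -f z := by
    simp only [hf, hqfun_neg, thetaQuot_neg]
    ring
  have hz0 : f z = 0 := by
    rw [apply_eq_apply_of_periodic hq0 hq1 hper hd (neg_ne_zero.2 hz) hz] at hodd
    exact self_eq_neg.1 hodd
  rw [sub_eq_zero.1 hz0, thetaQuot, thetaNum, thetaDen]
  ring
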